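/- arXiv:2401.01957 — 2 statements merged into one kernel-verified Lean document; each statement's English description precedes it below -/
import Mathlib

section
/- For every t ∈ 𝔗_∞, the extended map Φ_t^{321} takes only finite values and is a bijection from ℕ to ℕ. Here Φ_t^{321} is defined by Φ_t^{321}(s_i − p_i + 1) = s_i for i ≥ 1, where (l_1, l_2, …) are the leaves of t to the left of the infinite spine in increasing lexicographic order, s_i = #{v ∈ t : v < l_i}, p_i = |l_i|, and Φ_t^{321} is extended to ℕ ∖ {s_i − p_i + 1 : i ≥ 1} by the unique increasing bijection onto ℕ ∖ {s_i : i ≥ 1}. -/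
open Set Filter MeasureTheory Topology TopologicalSpace
open scoped ENNReal

namespace AvoidPaper

/-- Instances for the codomain `ℕ∞` (one-point compactification of `ℕ`). -/
instance : SecondCountableTopology ℕ∞ := by
  have h : ({s : Set ℕ∞ | ∃ a, s = Set.Ioi a ∨ s = Set.Iio a}).Countable := by
    have hsub : {s : Set ℕ∞ | ∃ a, s = Set.Ioi a ∨ s = Set.Iio a}
        ⊆ Set.range (Set.Ioi : ℕ∞ → Set ℕ∞) ∪ Set.range (Set.Iio : ℕ∞ → Set ℕ∞) := by
      rintro s ⟨a, rfl | rfl⟩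
      · exact Or.inl ⟨a, rfl⟩
      · exact Or.inr ⟨a, rfl⟩
    exact ((Set.countable_range _).union (Set.countable_range _)).mono hsub
  exact SecondCountableTopology.mk' h

instance : OpensMeasurableSpace ℕ∞ := ⟨le_top⟩

/-! ## Ulam–Harris vertices and rooted ordered trees -/

/-- A vertex of the Ulam–Harris tree: a finite list of natural numbers (children indices),
ordered lexicographically (so an ancestor precedes its descendants). -/
abbrev Vertex : Type := List ℕ

/-- A (rooted ordered) tree: contains the root, is closed under ancestors, and is
left-closed among siblings. -/
def IsTree (t : Set Vertex) : Prop :=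
  ([] : Vertex) ∈ t ∧ (∀ u v : Vertex, u ++ v ∈ t → u ∈ t) ∧
    ∀ (u : Vertex) (i j : ℕ), u ++ [i] ∈ t → j ≤ i → u ++ [j] ∈ t

/-- The set of children indices of `u` in `t`. -/
def children (t : Set Vertex) (u : Vertex) : Set ℕ := {i | u ++ [i] ∈ t}

/-- Locally finite tree. -/
def LocFin (t : Set Vertex) : Prop := ∀ u : Vertex, (children t u).Finite

/-- Number of children of `u` in `t`. -/
noncomputable def childCount (t : Set Vertex) (u : Vertex) : ℕ := (children t u).ncard

/-- The degree function `d_t(u)`: number of children, and `-1` if `u ∉ t`. -/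
noncomputable def deg (t : Set Vertex) (u : Vertex) : ℤ :=
  haveI := Classical.dec (u ∈ t)
  if u ∈ t then (childCount t u : ℤ) else -1

/-- `t^[m]`: restriction of `t` to the vertices of height at most `m`. -/
def trunc (t : Set Vertex) (m : ℕ) : Set Vertex := {u ∈ t | u.length ≤ m}

/-- Local convergence of trees: `d_{t_n}(u) → d_t(u)` for every vertex `u`
(equivalently, eventual equality, since degrees are integers). -/
def LocalConv (ts : ℕ → Set Vertex) (t : Set Vertex) : Prop :=
  ∀ u : Vertex, ∀ᶠ n in atTop, deg (ts n) u = deg t u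

/-- A leaf: a vertex of `t` with no children. -/
def IsLeaf (t : Set Vertex) (v : Vertex) : Prop := v ∈ t ∧ ∀ i : ℕ, v ++ [i] ∉ t

def leafSet (t : Set Vertex) : Set Vertex := {v | IsLeaf t v}

/-- The fringe subtree `t_v` of `t` at `v` (as a subset of `t`). -/
def fringe (t : Set Vertex) (v : Vertex) : Set Vertex := {x ∈ t | v <+: x}

/-- Number of vertices of `t` at height exactly `k`. -/
noncomputable def levelCount (t : Set Vertex) (k : ℕ) : ℕ := {u ∈ t | u.length = k}.ncard

/-- An infinite spine of `t`: `η 0` is the root and `η (i+1)` is a child of `η i`. -/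
def IsSpine (t : Set Vertex) (η : ℕ → Vertex) : Prop :=
  η 0 = [] ∧ (∀ i, η i ∈ t) ∧ ∀ i, ∃ c : ℕ, η (i + 1) = η i ++ [c]

/-- `v` lies strictly to the left of the spine `η`. -/
def LeftOfSpine (t : Set Vertex) (η : ℕ → Vertex) (v : Vertex) : Prop :=
  v ∈ t ∧ (∀ i, η i ≠ v) ∧ ∃ j, v < η j

/-- `v` lies strictly to the right of the spine `η`. -/
def RightOfSpine (t : Set Vertex) (η : ℕ → Vertex) (v : Vertex) : Prop :=
  v ∈ t ∧ ∀ j, η j < v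

/-- `η` is the unique infinite spine of `t`, with infinitely many subtrees attached to
the left and to the right of the spine, infinitely many of the left ones having at
least two vertices. -/
def SpineSpec (t : Set Vertex) (η : ℕ → Vertex) : Prop :=
  IsSpine t η ∧ (∀ η', IsSpine t η' → η' = η) ∧
  {u : Vertex | (∃ k c, u = η k ++ [c]) ∧ LeftOfSpine t η u}.Infinite ∧
  {u : Vertex | (∃ k c, u = η k ++ [c]) ∧ RightOfSpine t η u}.Infinite ∧
  {u : Vertex | (∃ k c, u = η k ++ [c]) ∧ LeftOfSpine t η u ∧
      2 ≤ (fringe t u).encard}.Infinite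

/-- `𝔗_f`: finite trees with at least two vertices. -/
def MemTf (t : Set Vertex) : Prop := IsTree t ∧ t.Finite ∧ 2 ≤ t.encard

/-- `𝔗_∞`. -/
def MemTinf (t : Set Vertex) : Prop :=
  IsTree t ∧ LocFin t ∧ t.Infinite ∧ ∃ η : ℕ → Vertex, SpineSpec t η

/-- The leaves of `t` lying to the left of the spine `η`. -/
def leftLeaves (t : Set Vertex) (η : ℕ → Vertex) : Set Vertex :=
  {x | IsLeaf t x ∧ LeftOfSpine t η x}

/-- `v` is the enumeration `(v_{t,i})` of (an initial part of) `t` in increasing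
lexicographic order: `v i ∈ t` and the vertices of `t` smaller than `v i` are
exactly `v 0, …, v (i-1)`. -/
def IsLexEnum (t : Set Vertex) (v : ℕ → Vertex) : Prop :=
  ∀ i : ℕ, (i : ℕ∞) < t.encard →
    v i ∈ t ∧ {x ∈ t | x < v i} = v '' {j | j < i}

/-- `w` is the enumeration `(w_{t,i})` of (a final part of) `t` in decreasing
lexicographic order, starting from the lexicographically largest vertex. -/
def IsLexCoEnum (t : Set Vertex) (w : ℕ → Vertex) : Prop :=
  ∀ i : ℕ, (i : ℕ∞) < t.encard →
    w i ∈ t ∧ {x ∈ t | w i < x} = w '' {j | j < i}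

/-- `l` enumerates the set `A` in increasing lexicographic order. -/
def IsEnumOf (A : Set Vertex) (l : ℕ → Vertex) : Prop :=
  ∀ i : ℕ, (i : ℕ∞) < A.encard →
    l i ∈ A ∧ {x ∈ A | x < l i} = l '' {j | j < i}

/-- `s_i`: the number of vertices of `t` lexicographically smaller than the `i`-th leaf
(0-indexed: `l 0` is the paper's `l_1`). -/
noncomputable def sVal (t : Set Vertex) (l : ℕ → Vertex) (i : ℕ) : ℕ :=
  {x ∈ t | x < l i}.ncard

/-- `p_i`: the height of the `i`-th leaf. -/
def pVal (l : ℕ → Vertex) (i : ℕ) : ℕ := (l i).length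

/-! ## The maps Φ^σ -/

/-- `Φ^{231}` as an element of `F(ℕ, ℕ*)` (value `i` outside the range of indices). -/
noncomputable def phi231 (t : Set Vertex) (v : ℕ → Vertex) : ℕ → ℕ∞ := fun i =>
  if 1 ≤ i ∧ (i : ℕ∞) < t.encard then
    ((i : ℕ∞) + (fringe t (v i)).encard) - ((v i).length : ℕ∞)
  else (i : ℕ∞)

noncomputable def phi213 (t : Set Vertex) (v : ℕ → Vertex) : ℕ → ℕ∞ := fun i =>
  if 1 ≤ i ∧ (i : ℕ∞) < t.encard then
    ((t \ fringe t (v i)).encard + ((v i).length : ℕ∞)) - (i : ℕ∞)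
  else (i : ℕ∞)

noncomputable def phi312 (t : Set Vertex) (w : ℕ → Vertex) : ℕ → ℕ∞ := fun i =>
  if 1 ≤ i ∧ (i : ℕ∞) < t.encard then
    ((i : ℕ∞) + ((w (i - 1)).length : ℕ∞)) - (fringe t (w (i - 1))).encard
  else (i : ℕ∞)

noncomputable def phi132 (t : Set Vertex) (w : ℕ → Vertex) : ℕ → ℕ∞ := fun i =>
  if 1 ≤ i ∧ (i : ℕ∞) < t.encard then
    ((t.encard + (fringe t (w (i - 1))).encard) - (i : ℕ∞)) - ((w (i - 1)).length : ℕ∞)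
  else (i : ℕ∞)

/-- `B = {s_i - p_i + 1 : i}` (with `i` ranging over indices `< L` of leaves). -/
def Bset (S P : ℕ → ℕ) (L : ℕ∞) : Set ℕ :=
  {b | ∃ i : ℕ, (i : ℕ∞) < L ∧ S i - P i + 1 = b}

/-- `A = {s_i : i}`. -/
def Aset (S : ℕ → ℕ) (L : ℕ∞) : Set ℕ := {a | ∃ i : ℕ, (i : ℕ∞) < L ∧ S i = a}

/-- The number of elements of `C` in `{1, …, j}`. -/
noncomputable def rankIn (C : Set ℕ) (j : ℕ) : ℕ := (C ∩ Set.Icc 1 j).ncard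

/-- The `a`-th smallest positive element of `C`. -/
noncomputable def nthOf (C : Set ℕ) (a : ℕ) : ℕ :=
  sInf {m : ℕ | a ≤ (C ∩ Set.Icc 1 m).ncard}

open Classical in
/-- `Φ^{321}` built from the data `s, p` (and the number `L` of leaves):
`s_i - p_i + 1 ↦ s_i`, extended by the unique increasing bijection between the
complements (and by the identity outside `[1, n]` in the finite case). -/
noncomputable def phi321Fun (S P : ℕ → ℕ) (L : ℕ∞) : ℕ → ℕ∞ := fun j =>
  if h : j ∈ Bset S P L then (S h.choose : ℕ∞)
  else (nthOf (Aset S L)ᶜ (rankIn (Bset S P L)ᶜ j) : ℕ∞)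

/-- `Φ^{123} = |t| + 1 - Φ^{321}` as an element of `F(ℕ, ℕ*)`. -/
noncomputable def phi123Fun (tc : ℕ∞) (f : ℕ → ℕ∞) : ℕ → ℕ∞ := fun j =>
  if 1 ≤ j ∧ (j : ℕ∞) < tc then (tc + 1) - f j else (j : ℕ∞)

/-! ## Patterns and pattern avoidance -/

def p123 : Equiv.Perm (Fin 3) := Equiv.refl _
noncomputable def p321 : Equiv.Perm (Fin 3) := Equiv.ofBijective ![2, 1, 0] (by decide)
noncomputable def p231 : Equiv.Perm (Fin 3) := Equiv.ofBijective ![1, 2, 0] (by decide)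
noncomputable def p213 : Equiv.Perm (Fin 3) := Equiv.ofBijective ![1, 0, 2] (by decide)
noncomputable def p312 : Equiv.Perm (Fin 3) := Equiv.ofBijective ![2, 0, 1] (by decide)
noncomputable def p132 : Equiv.Perm (Fin 3) := Equiv.ofBijective ![0, 2, 1] (by decide)

/-- `π` contains the length-3 pattern `σ`. -/
def ContainsPat {n : ℕ} (π : Equiv.Perm (Fin n)) (σ : Equiv.Perm (Fin 3)) : Prop :=
  ∃ f : Fin 3 → Fin n, StrictMono f ∧ ∀ j k : Fin 3, σ j < σ k ↔ π (f j) < π (f k)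

/-- `π` avoids the length-3 pattern `σ`. -/
def AvoidsPat {n : ℕ} (π : Equiv.Perm (Fin n)) (σ : Equiv.Perm (Fin 3)) : Prop :=
  ¬ ContainsPat π σ

/-- Trees with `n+1` vertices. -/
def TreeN (n : ℕ) : Type := {t : Set Vertex // IsTree t ∧ t.encard = (n : ℕ∞) + 1}

/-- Embedding of a permutation of `[n]` into `F(ℕ, ℕ*)` by `π(k) = k` for `k > n`
(permutations are `1`-indexed: position `k ∈ [1, n]` corresponds to `k - 1 : Fin n`). -/
noncomputable def embedPerm {n : ℕ} (π : Equiv.Perm (Fin n)) : ℕ → ℕ∞ := fun k =>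
  if h : 1 ≤ k ∧ k ≤ n then (((π ⟨k - 1, by omega⟩ : Fin n) : ℕ) + 1 : ℕ) else (k : ℕ∞)

/-- The (finite) set of permutations of `[n]` avoiding `σ`. -/
noncomputable def avoidFinset (σ : Equiv.Perm (Fin 3)) (n : ℕ) : Finset (Equiv.Perm (Fin n)) :=
  Set.Finite.toFinset (Set.toFinite {π : Equiv.Perm (Fin n) | AvoidsPat π σ})

/-- The law of a uniformly random `σ`-avoiding permutation of `[n]`,
as a measure on `F(ℕ, ℕ*)`. -/
noncomputable def uniformAvoidLaw (σ : Equiv.Perm (Fin 3)) (n : ℕ) : Measure (ℕ → ℕ∞) :=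
  ((avoidFinset σ n).card : ℝ≥0∞)⁻¹ • ∑ π ∈ avoidFinset σ n, Measure.dirac (embedPerm π)


open Classical in
/-- `Φ^σ` for an arbitrary pattern `σ ∈ S_3`, given a tree together with its increasing
vertex enumeration `v`, its decreasing vertex enumeration `w`, and the increasing
enumeration `l` of the relevant set `Lset` of leaves. -/
noncomputable def PhiOf (σ : Equiv.Perm (Fin 3)) (t : Set Vertex)
    (v w l : ℕ → Vertex) (Lset : Set Vertex) : ℕ → ℕ∞ :=
  if σ = p231 then phi231 t v
  else if σ = p213 then phi213 t v
  else if σ = p312 then phi312 t w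
  else if σ = p132 then phi132 t w
  else if σ = p321 then phi321Fun (sVal t l) (pVal l) Lset.encard
  else phi123Fun t.encard (phi321Fun (sVal t l) (pVal l) Lset.encard)

open Classical in
noncomputable def canonSpine (t : Set Vertex) : ℕ → Vertex :=
  if h : ∃ η : ℕ → Vertex, IsSpine t η then h.choose else fun _ => []

open Classical in
noncomputable def canonV (t : Set Vertex) : ℕ → Vertex :=
  if h : ∃ v : ℕ → Vertex, IsLexEnum t v then h.choose else fun _ => []

open Classical in
noncomputable def canonW (t : Set Vertex) : ℕ → Vertex :=
  if h : ∃ w : ℕ → Vertex, IsLexCoEnum t w then h.choose else fun _ => []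

open Classical in
noncomputable def canonL (t : Set Vertex) : ℕ → Vertex :=
  if h : ∃ l : ℕ → Vertex, IsEnumOf (leftLeaves t (canonSpine t)) l then h.choose
  else fun _ => []

/-- `Φ^σ_t` for an infinite tree `t ∈ 𝔗_∞`, using the canonical (unique) spine and
enumerations. -/
noncomputable def PhiCanon (σ : Equiv.Perm (Fin 3)) (t : Set Vertex) : ℕ → ℕ∞ :=
  PhiOf σ t (canonV t) (canonW t) (canonL t) (leftLeaves t (canonSpine t))

/-- σ-algebra on the space of trees: all sets are measurable. -/
instance : MeasurableSpace (Set Vertex) := ⊤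

/-- `μ` is the law of a Galton–Watson tree with offspring distribution `ξ`:
a probability measure, supported on trees, giving each finite tree `t` the
probability `∏_{u ∈ t} ξ(d_t(u))`. -/
def IsGW (ξ : ℕ → ℝ≥0∞) (μ : Measure (Set Vertex)) : Prop :=
  IsProbabilityMeasure μ ∧ μ {t | IsTree t} = 1 ∧
    ∀ t : Set Vertex, IsTree t → ∀ ht : t.Finite,
      μ {t} = ∏ u ∈ ht.toFinset, ξ (childCount t u)

/-- `π` is the permutation `Φ^{321}_t` of `[n]` associated to a finite tree `t` with
`n+1` vertices: for every leaf `v` with `s = #{x ∈ t : x < v}` and `p = |v|`, position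
`s - p + 1` is mapped to `s` (in 0-indexed form: position `s - p` to value `s - 1`),
and `π` is increasing on the remaining positions. -/
def Is321Image (n : ℕ) (t : Set Vertex) (π : Equiv.Perm (Fin n)) : Prop :=
  (∀ v : Vertex, IsLeaf t v →
    ∃ hb : {x ∈ t | x < v}.ncard - v.length < n,
      ((π ⟨{x ∈ t | x < v}.ncard - v.length, hb⟩ : Fin n) : ℕ)
        = {x ∈ t | x < v}.ncard - 1) ∧
  ∀ a b : Fin n, a < b →
    (∀ v : Vertex, IsLeaf t v → {x ∈ t | x < v}.ncard - v.length ≠ (a : ℕ)) →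
    (∀ v : Vertex, IsLeaf t v → {x ∈ t | x < v}.ncard - v.length ≠ (b : ℕ)) →
    π a < π b

/-- `π` is the permutation `Φ^{123}_t = (n+1) - Φ^{321}_t` of `[n]`. -/
def Is123Image (n : ℕ) (t : Set Vertex) (π : Equiv.Perm (Fin n)) : Prop :=
  ∃ π' : Equiv.Perm (Fin n), Is321Image n t π' ∧ ∀ i : Fin n, π i = Fin.rev (π' i)


/-! ### Lexicographic order and prefixes -/

theorem isPrefix_le {u x : Vertex} (h : u <+: x) : u ≤ x := by
  rw [← not_lt]
  induction u generalizing x with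
  | nil => exact List.not_lt_nil _
  | cons a u ih =>
    obtain ⟨r, rfl⟩ := h
    rw [List.cons_append, List.cons_lt_cons_iff]
    rintro (h | ⟨-, h⟩)
    · exact lt_irrefl _ h
    · exact ih (List.prefix_append _ _) h

theorem isPrefix_lt {u x : Vertex} (h : u <+: x) (hne : u ≠ x) : u < x :=
  lt_of_le_of_ne (isPrefix_le h) hne

/-- The descendants of a vertex form an interval. -/
theorem isPrefix_of_lt_lt {u x y : Vertex} (h1 : u < x) (h2 : x < y) (h : u <+: y) :
    u <+: x := by
  induction u generalizing x y with
  | nil => exact ⟨x, rfl⟩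
  | cons a u ih =>
    obtain ⟨r, rfl⟩ := h
    cases x with
    | nil => exact absurd h1 (List.not_lt_nil _)
    | cons b x =>
      rw [List.cons_append] at h2
      rw [List.cons_lt_cons_iff] at h1 h2
      rcases h1 with h1 | ⟨rfl, h1⟩
      · omega
      · rcases h2 with h2 | ⟨-, h2⟩
        · omega
        · rw [List.cons_prefix_cons]
          exact ⟨rfl, ih h1 h2 (List.prefix_append _ _)⟩

/-- If `y` comes after `u` and is not a descendant of `u`, it comes after all descendants. -/
theorem lt_of_isPrefix_of_lt {u x y : Vertex} (h : u <+: x) (h1 : u < y) (h2 : ¬ u <+: y) :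
    x < y := by
  rcases lt_trichotomy x y with h3 | rfl | h3
  · exact h3
  · exact absurd h h2
  · exact absurd (isPrefix_of_lt_lt h1 h3 h) h2

/-! ### Finiteness to the left of the spine -/

/-- Vertices of `t` before `v` which are not ancestors of `v`. -/
def beforeSet (t : Set Vertex) (v : Vertex) : Set Vertex := {x ∈ t | x < v ∧ ¬ x <+: v}

theorem beforeSet_mono {t : Set Vertex} {v w : Vertex} (h : v < w) :
    beforeSet t v ⊆ beforeSet t w := fun _ ⟨hx, h1, h2⟩ =>
  ⟨hx, h1.trans h, fun h3 => h2 (isPrefix_of_lt_lt h1 h h3)⟩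

theorem exists_child_infinite {t F : Set Vertex} (h1 : IsTree t) (h2 : LocFin t) (hF : F ⊆ t)
    {u : Vertex} (hu : {x ∈ F | u <+: x}.Infinite) :
    ∃ c, {x ∈ F | u ++ [c] <+: x}.Infinite := by
  by_contra! hcon
  apply hu
  have hfin : ({u} ∪ ⋃ c ∈ children t u, {x ∈ F | u ++ [c] <+: x}).Finite :=
    (Set.finite_singleton u).union
      ((h2 u).biUnion fun c _ => Set.not_infinite.mp (by simpa using hcon c))
  refine hfin.subset ?_
  rintro x ⟨hx, r, rfl⟩
  cases r with
  | nil => simp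
  | cons c r =>
    have e : u ++ c :: r = (u ++ [c]) ++ r := by simp
    refine Or.inr (Set.mem_biUnion (x := c) (h1.2.1 _ r (e ▸ hF hx)) ⟨hx, ?_⟩)
    rw [e]
    exact List.prefix_append _ _

theorem exists_spine_of_infinite {t F : Set Vertex} (h1 : IsTree t) (h2 : LocFin t)
    (hF : F ⊆ t) (hinf : F.Infinite) :
    ∃ η, IsSpine t η ∧ ∀ i, {x ∈ F | η i <+: x}.Infinite := by
  let T := {u : Vertex // {x ∈ F | u <+: x}.Infinite}
  have step : ∀ u : T, ∃ w : T, ∃ c, w.1 = u.1 ++ [c] := fun u =>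
    let ⟨c, hc⟩ := exists_child_infinite h1 h2 hF u.2
    ⟨⟨_, hc⟩, c, rfl⟩
  choose f hf using step
  let η : ℕ → T := fun n => Nat.rec ⟨[], by simpa using hinf⟩ (fun _ u => f u) n
  refine ⟨fun n => (η n).1, ⟨rfl, fun i => ?_, fun i => hf (η i)⟩, fun i => (η i).2⟩
  obtain ⟨x, hx, r, rfl⟩ := (η i).2.nonempty
  exact h1.2.1 _ r (hF hx)

theorem finite_lt_spine {t : Set Vertex} {η : ℕ → Vertex} (h1 : IsTree t) (h2 : LocFin t)
    (huniq : ∀ η', IsSpine t η' → η' = η) (j : ℕ) : {x ∈ t | x < η j}.Finite := by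
  by_contra hinf
  obtain ⟨η', hs, hη'⟩ := exists_spine_of_infinite h1 h2 (fun _ hx => hx.1) hinf
  obtain rfl := huniq η' hs
  obtain ⟨x, hx, hp⟩ := (hη' j).nonempty
  exact absurd hx.2 (not_lt.mpr (isPrefix_le hp))

/-! ### The spine -/

theorem exists_spine_eq_of_isPrefix {t : Set Vertex} {η : ℕ → Vertex} (h : IsSpine t η)
    {u : Vertex} {k : ℕ}
    (hu : u <+: η k) : ∃ i, η i = u := by
  induction k with
  | zero =>
    rw [h.1, List.prefix_nil] at hu
    exact ⟨0, by rw [h.1, hu]⟩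
  | succ k ih =>
    obtain ⟨c, hc⟩ := h.2.2 k
    rw [hc, List.prefix_concat_iff] at hu
    rcases hu with rfl | hu
    · exact ⟨k + 1, hc⟩
    · exact ih hu

theorem spine_strictMono {t : Set Vertex} {η : ℕ → Vertex} (h : IsSpine t η) :
    StrictMono η := by
  refine strictMono_nat_of_lt_succ fun i => ?_
  obtain ⟨c, hc⟩ := h.2.2 i
  rw [hc]
  exact isPrefix_lt (List.prefix_append _ _) (by simp)

/-! ### Counting -/

theorem ncard_strictPrefixes (v : Vertex) : {x : Vertex | x <+: v ∧ x ≠ v}.ncard = v.length := by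
  have e : {x : Vertex | x <+: v ∧ x ≠ v} = (fun n => v.take n) '' Set.Iio v.length := by
    ext x
    constructor
    · rintro ⟨hp, hne⟩
      refine ⟨x.length, ?_, (List.prefix_iff_eq_take.mp hp).symm⟩
      exact lt_of_le_of_ne hp.length_le fun h => hne (hp.eq_of_length h)
    · rintro ⟨n, hn, rfl⟩
      refine ⟨⟨_, List.take_append_drop _ _⟩, fun h => ?_⟩
      have := congrArg List.length h
      simp only [List.length_take, Set.mem_Iio] at this hn
      omega
  rw [e, Set.InjOn.ncard_image]
  · rw [← Finset.coe_Iio, Set.ncard_coe_finset, Nat.card_Iio]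
  · intro a ha b hb hab
    have := congrArg List.length hab
    simp only [List.length_take, Set.mem_Iio] at this ha hb
    omega

theorem ncard_lt_eq {t : Set Vertex} (h1 : IsTree t) {v : Vertex} (hv : v ∈ t)
    (hfin : {x ∈ t | x < v}.Finite) :
    {x ∈ t | x < v}.ncard = v.length + (beforeSet t v).ncard := by
  have e : {x ∈ t | x < v} = {x : Vertex | x <+: v ∧ x ≠ v} ∪ beforeSet t v := by
    ext x
    constructor
    · rintro ⟨hx, hlt⟩
      by_cases hp : x <+: v
      · exact Or.inl ⟨hp, hlt.ne⟩
      · exact Or.inr ⟨hx, hlt, hp⟩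
    · rintro (⟨hp, hne⟩ | ⟨hx, hlt, -⟩)
      · obtain ⟨r, rfl⟩ := hp
        exact ⟨h1.2.1 _ r hv, isPrefix_lt (List.prefix_append _ _) hne⟩
      · exact ⟨hx, hlt⟩
  have hf := hfin
  rw [e] at hf
  rw [e, Set.ncard_union_eq _ (hf.subset Set.subset_union_left)
    (hf.subset Set.subset_union_right), ncard_strictPrefixes]
  exact Set.disjoint_left.mpr fun x hx hx' => hx'.2.2 hx.1

theorem IsLeaf.not_isPrefix {t : Set Vertex} {v w : Vertex} (hv : IsLeaf t v) (h1 : IsTree t)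
    (hw : w ∈ t) (h : v < w) : ¬ v <+: w := by
  rintro ⟨r, rfl⟩
  cases r with
  | nil => simp at h
  | cons c r => exact hv.2 c (h1.2.1 _ r (by simpa using hw))

theorem beforeSet_ssubset {t : Set Vertex} {v w : Vertex} (hv : IsLeaf t v) (h1 : IsTree t)
    (hw : w ∈ t) (h : v < w) : beforeSet t v ⊂ beforeSet t w :=
  (Set.ssubset_iff_of_subset (beforeSet_mono h)).mpr
    ⟨v, ⟨hv.1, h, hv.not_isPrefix h1 hw h⟩, fun h' => lt_irrefl _ h'.2.1⟩

theorem not_isLeaf_of_two_le_fringe {t : Set Vertex} (h1 : IsTree t) {u : Vertex}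
    (h : 2 ≤ (fringe t u).encard) : ¬ IsLeaf t u := by
  intro hl
  have hsub : fringe t u ⊆ {u} := by
    rintro x ⟨hx, r, rfl⟩
    cases r with
    | nil => simp
    | cons c r => exact absurd (h1.2.1 _ r (by simpa using hx)) (hl.2 c)
  have := h.trans (Set.encard_le_encard hsub)
  rw [Set.encard_singleton] at this
  exact absurd this (by decide)

/-- For a non-leaf `u` and a leaf `v`, the number of vertices before `v` that are not ancestors
of `v` is never one less than the number of vertices which are descendants of `u`, or before `u`
and not ancestors of `u`. -/
theorem ncard_beforeSet_ne {t : Set Vertex} (h1 : IsTree t) {u v : Vertex} (hu : u ∈ t)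
    (hul : ¬ IsLeaf t u) (hv : IsLeaf t v) (hfu : (beforeSet t u ∪ fringe t u).Finite)
    (hfv : (beforeSet t v).Finite) :
    (beforeSet t v).ncard + 1 ≠ (beforeSet t u ∪ fringe t u).ncard := by
  have hne : u ≠ v := fun h => hul (h ▸ hv)
  by_cases hc : u < v ∧ ¬ u <+: v
  · have hsub : beforeSet t u ∪ fringe t u ⊆ beforeSet t v := by
      refine Set.union_subset (beforeSet_mono hc.1) ?_
      rintro x ⟨hx, hp⟩
      exact ⟨hx, lt_of_isPrefix_of_lt hp hc.1 hc.2, fun h => hc.2 (hp.trans h)⟩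
    have := Set.ncard_le_ncard hsub hfv
    omega
  · have hu_not : u ∉ beforeSet t v := fun h => hc h.2
    have hv_not : v ∉ beforeSet t v := fun h => lt_irrefl _ h.2.1
    have hsub : insert u (insert v (beforeSet t v)) ⊆ beforeSet t u ∪ fringe t u := by
      refine Set.insert_subset (Or.inr ⟨hu, List.prefix_rfl⟩) ?_
      by_cases hp : u <+: v
      · refine Set.insert_subset (Or.inr ⟨hv.1, hp⟩) ?_
        rintro x ⟨hx, hlt, hnp⟩
        rcases lt_trichotomy x u with h | rfl | h
        · exact Or.inl ⟨hx, h, fun h' => hnp (h'.trans hp)⟩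
        · exact absurd hp hnp
        · exact Or.inr ⟨hx, isPrefix_of_lt_lt h hlt hp⟩
      · have hlt : v < u := lt_of_le_of_ne (not_lt.mp fun h => hc ⟨h, hp⟩) hne.symm
        exact Set.insert_subset (Or.inl ⟨hv.1, hlt, hv.not_isPrefix h1 hu hlt⟩)
          ((beforeSet_mono hlt).trans Set.subset_union_left)
    have := Set.ncard_le_ncard hsub hfu
    rw [Set.ncard_insert_of_notMem (by simp [hne, hu_not]) (hfv.insert v),
      Set.ncard_insert_of_notMem hv_not hfv] at this
    omega

/-- Counting positions strictly increases along incomparable vertices. -/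
theorem beforeSet_union_fringe_ssubset {t : Set Vertex} {u v : Vertex} (hv : v ∈ t)
    (h : u < v) (hp : ¬ u <+: v) :
    beforeSet t u ∪ fringe t u ⊂ beforeSet t v ∪ fringe t v := by
  have hsub : beforeSet t u ∪ fringe t u ⊆ beforeSet t v := by
    refine Set.union_subset (beforeSet_mono h) ?_
    rintro x ⟨hx, hux⟩
    exact ⟨hx, lt_of_isPrefix_of_lt hux h hp, fun h' => hp (hux.trans h')⟩
  refine (Set.ssubset_iff_of_subset (hsub.trans Set.subset_union_left)).mpr
    ⟨v, Or.inr ⟨hv, List.prefix_rfl⟩, fun h' => lt_irrefl _ (hsub h').2.1⟩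

/-! ### Ranks -/

theorem rankIn_zero (C : Set ℕ) : rankIn C 0 = 0 := by simp [rankIn]

theorem rankIn_mono (C : Set ℕ) : Monotone (rankIn C) := fun _ _ h =>
  Set.ncard_le_ncard (Set.inter_subset_inter_right _ (Set.Icc_subset_Icc_right h))
    ((Set.finite_Icc _ _).inter_of_right _)

theorem rankIn_succ_mem {C : Set ℕ} {m : ℕ} (h : m + 1 ∈ C) :
    rankIn C (m + 1) = rankIn C m + 1 := by
  have e : C ∩ Set.Icc 1 (m + 1) = insert (m + 1) (C ∩ Set.Icc 1 m) := by
    ext x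
    simp only [Set.mem_inter_iff, Set.mem_Icc, Set.mem_insert_iff]
    constructor
    · rintro ⟨hx, h1, h2⟩
      rcases Nat.lt_or_ge m x with h3 | h3
      · left; omega
      · exact Or.inr ⟨hx, h1, h3⟩
    · rintro (rfl | ⟨hx, h1, h2⟩)
      · exact ⟨h, by omega, le_rfl⟩
      · exact ⟨hx, h1, by omega⟩
  rw [rankIn, e, Set.ncard_insert_of_notMem (by simp)
    ((Set.finite_Icc _ _).inter_of_right _), rankIn]

theorem rankIn_succ_notMem {C : Set ℕ} {m : ℕ} (h : m + 1 ∉ C) :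
    rankIn C (m + 1) = rankIn C m := by
  have e : C ∩ Set.Icc 1 (m + 1) = C ∩ Set.Icc 1 m := by
    ext x
    simp only [Set.mem_inter_iff, Set.mem_Icc]
    constructor
    · rintro ⟨hx, h1, h2⟩
      have : x ≠ m + 1 := fun h' => h (h' ▸ hx)
      exact ⟨hx, h1, by omega⟩
    · rintro ⟨hx, h1, h2⟩
      exact ⟨hx, h1, by omega⟩
  rw [rankIn, e, rankIn]

theorem exists_le_rankIn {C : Set ℕ} (hC : C.Infinite) (a : ℕ) : ∃ m, a ≤ rankIn C m := by
  induction a with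
  | zero => exact ⟨0, Nat.zero_le _⟩
  | succ a ih =>
    obtain ⟨m, hm⟩ := ih
    obtain ⟨n, hn, hlt⟩ := hC.exists_gt m
    obtain ⟨k, rfl⟩ : ∃ k, n = k + 1 := ⟨n - 1, by omega⟩
    refine ⟨k + 1, ?_⟩
    rw [rankIn_succ_mem hn]
    exact Nat.succ_le_succ (hm.trans (rankIn_mono C (by omega)))

theorem nthOf_rankIn {C : Set ℕ} {j : ℕ} (hj : j ∈ C) : nthOf C (rankIn C j) = j := by
  refine le_antisymm (Nat.sInf_le (le_refl (rankIn C j))) ?_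
  refine le_csInf ⟨j, le_refl (rankIn C j)⟩ fun m hm => ?_
  by_contra! hlt
  obtain ⟨k, rfl⟩ : ∃ k, j = k + 1 := ⟨j - 1, by omega⟩
  have h1 : rankIn C (k + 1) ≤ rankIn C m := hm
  have h2 := rankIn_mono C (show m ≤ k by omega)
  rw [rankIn_succ_mem hj] at h1
  omega

theorem exists_mem_rankIn_eq {C : Set ℕ} (hC : C.Infinite) (h0 : 0 ∈ C) (a : ℕ) :
    ∃ j ∈ C, rankIn C j = a := by
  cases a with
  | zero => exact ⟨0, h0, rankIn_zero C⟩
  | succ a =>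
    have hex := exists_le_rankIn hC (a + 1)
    classical
    obtain ⟨k, hk⟩ : ∃ k, Nat.find hex = k + 1 := by
      refine Nat.exists_eq_succ_of_ne_zero fun h => ?_
      have := Nat.find_spec hex
      rw [h, rankIn_zero] at this
      omega
    have h1 := Nat.find_spec hex
    have h2 := Nat.find_min hex (m := k) (by omega)
    rw [hk] at h1
    by_cases hmem : k + 1 ∈ C
    · refine ⟨k + 1, hmem, ?_⟩
      rw [rankIn_succ_mem hmem] at h1 ⊢
      omega
    · rw [rankIn_succ_notMem hmem] at h1
      omega

theorem nthOf_mem {C : Set ℕ} (hC : C.Infinite) (h0 : 0 ∈ C) (a : ℕ) : nthOf C a ∈ C := by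
  obtain ⟨j, hj, rfl⟩ := exists_mem_rankIn_eq hC h0 a
  rwa [nthOf_rankIn hj]

theorem rankIn_nthOf {C : Set ℕ} (hC : C.Infinite) (h0 : 0 ∈ C) (a : ℕ) :
    rankIn C (nthOf C a) = a := by
  obtain ⟨j, hj, rfl⟩ := exists_mem_rankIn_eq hC h0 a
  rw [nthOf_rankIn hj]

open Classical in
theorem phi321Fun_bijective {S P : ℕ → ℕ} {L : ℕ∞}
    (hS : Set.InjOn S {i | (i : ℕ∞) < L})
    (hB : Set.InjOn (fun i => S i - P i + 1) {i | (i : ℕ∞) < L})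
    (hS0 : ∀ i : ℕ, (i : ℕ∞) < L → S i ≠ 0)
    (hAinf : (Aset S L)ᶜ.Infinite) (hBinf : (Bset S P L)ᶜ.Infinite) :
    ∃ g : ℕ → ℕ, Function.Bijective g ∧ ∀ j : ℕ, phi321Fun S P L j = (g j : ℕ∞) := by
  have hA0 : 0 ∈ (Aset S L)ᶜ := fun ⟨i, hi, h⟩ => hS0 i hi h
  have hB0 : 0 ∈ (Bset S P L)ᶜ := fun ⟨i, hi, h⟩ => by omega
  let g : ℕ → ℕ := fun j =>
    if h : j ∈ Bset S P L then S h.choose else nthOf (Aset S L)ᶜ (rankIn (Bset S P L)ᶜ j)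
  have hg1 : ∀ i : ℕ, (i : ℕ∞) < L → g (S i - P i + 1) = S i := by
    intro i hi
    have h : S i - P i + 1 ∈ Bset S P L := ⟨i, hi, rfl⟩
    simp only [g, dif_pos h]
    exact congrArg S (hB h.choose_spec.1 hi h.choose_spec.2)
  have hg2 : ∀ j ∉ Bset S P L, g j = nthOf (Aset S L)ᶜ (rankIn (Bset S P L)ᶜ j) :=
    fun j hj => dif_neg hj
  have hg3 : ∀ j ∉ Bset S P L, g j ∉ Aset S L := fun j hj => by
    rw [hg2 j hj]
    exact nthOf_mem hAinf hA0 _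
  refine ⟨g, ⟨fun j k hjk => ?_, fun a => ?_⟩, fun j => ?_⟩
  · by_cases hj : j ∈ Bset S P L <;> by_cases hk : k ∈ Bset S P L
    · obtain ⟨i, hi, rfl⟩ := hj
      obtain ⟨i', hi', rfl⟩ := hk
      rw [hg1 i hi, hg1 i' hi'] at hjk
      rw [hS hi hi' hjk]
    · obtain ⟨i, hi, rfl⟩ := hj
      exact absurd ⟨i, hi, by rw [← hjk, hg1 i hi]⟩ (hg3 k hk)
    · obtain ⟨i, hi, rfl⟩ := hk
      exact absurd ⟨i, hi, by rw [hjk, hg1 i hi]⟩ (hg3 j hj)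
    · rw [hg2 j hj, hg2 k hk] at hjk
      have := congrArg (rankIn (Aset S L)ᶜ) hjk
      rw [rankIn_nthOf hAinf hA0, rankIn_nthOf hAinf hA0] at this
      rw [← nthOf_rankIn (C := (Bset S P L)ᶜ) hj, this, nthOf_rankIn (C := (Bset S P L)ᶜ) hk]
  · by_cases ha : a ∈ Aset S L
    · obtain ⟨i, hi, rfl⟩ := ha
      exact ⟨_, hg1 i hi⟩
    · refine ⟨nthOf (Bset S P L)ᶜ (rankIn (Aset S L)ᶜ a), ?_⟩
      rw [hg2 _ (nthOf_mem hBinf hB0 _), rankIn_nthOf hBinf hB0,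
        nthOf_rankIn (C := (Aset S L)ᶜ) ha]
  · by_cases hj : j ∈ Bset S P L <;> simp [phi321Fun, g, hj]

/-! ### Main theorem -/

/-- For every `t ∈ 𝔗_∞`, the extended map `Φ_t^{321}` takes only finite
values and is a bijection from `ℕ` to `ℕ`. -/
theorem phi321_bijective (t : Set Vertex) (η : ℕ → Vertex)
    (h1 : IsTree t) (h2 : LocFin t) (h3 : t.Infinite) (h4 : SpineSpec t η)
    (l : ℕ → Vertex) (hl : IsEnumOf (leftLeaves t η) l) :
    ∃ g : ℕ → ℕ, Function.Bijective g ∧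
      ∀ j : ℕ, phi321Fun (sVal t l) (pVal l) (leftLeaves t η).encard j = (g j : ℕ∞) := by
  obtain ⟨hs, huniq, -, -, hinf⟩ := h4
  have hfinη := finite_lt_spine h1 h2 huniq
  have hmono := spine_strictMono hs
  set L := (leftLeaves t η).encard
  have hmem : ∀ i : ℕ, (i : ℕ∞) < L → l i ∈ leftLeaves t η := fun i hi => (hl i hi).1
  have hlt : ∀ i i' : ℕ, i < i' → (i' : ℕ∞) < L → l i < l i' := by
    intro i i' h hi'
    have : l i ∈ l '' {j | j < i'} := ⟨i, h, rfl⟩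
    rw [← (hl i' hi').2] at this
    exact this.2
  have hfin : ∀ v, LeftOfSpine t η v → {x ∈ t | x < v}.Finite := by
    rintro v ⟨-, -, j, hj⟩
    exact (hfinη j).subset fun x hx => ⟨hx.1, hx.2.trans hj⟩
  have hbfin : ∀ v, LeftOfSpine t η v → (beforeSet t v).Finite := fun v hv =>
    (hfin v hv).subset fun x hx => ⟨hx.1, hx.2.1⟩
  have hufin : ∀ v, LeftOfSpine t η v → (beforeSet t v ∪ fringe t v).Finite := by
    rintro v ⟨hv, hne, j, hj⟩
    refine (hfinη j).subset (Set.union_subset (fun x hx => ⟨hx.1, hx.2.1.trans hj⟩) ?_)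
    rintro x ⟨hx, hp⟩
    refine ⟨hx, lt_of_isPrefix_of_lt hp hj fun h => ?_⟩
    obtain ⟨i, hi⟩ := exists_spine_eq_of_isPrefix hs h
    exact hne i hi
  have hcount : ∀ i : ℕ, (i : ℕ∞) < L →
      sVal t l i - pVal l i + 1 = (beforeSet t (l i)).ncard + 1 := by
    intro i hi
    have := ncard_lt_eq h1 (hmem i hi).1.1 (hfin _ (hmem i hi).2)
    simp only [sVal, pVal]
    omega
  have hrank : ∀ v w, v ∈ t → v < w → {x ∈ t | x < w}.Finite →
      {x ∈ t | x < v}.ncard < {x ∈ t | x < w}.ncard := by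
    intro v w hv hvw hf
    have hsub : {x ∈ t | x < v} ⊆ {x ∈ t | x < w} := fun x hx => ⟨hx.1, hx.2.trans hvw⟩
    exact Set.ncard_lt_ncard ((Set.ssubset_iff_of_subset hsub).mpr
      ⟨v, ⟨hv, hvw⟩, fun h => lt_irrefl _ h.2⟩) hf
  have injOn_of_lt : ∀ f : ℕ → ℕ,
      (∀ i i' : ℕ, i < i' → (i : ℕ∞) < L → (i' : ℕ∞) < L → f i < f i') →
      Set.InjOn f {i | (i : ℕ∞) < L} := fun f hf =>
    (show StrictMonoOn f {i | (i : ℕ∞) < L} from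
      fun i hi i' hi' h => hf i i' h hi hi').injOn
  apply phi321Fun_bijective
  · exact injOn_of_lt _ fun i i' h hi hi' =>
      hrank _ _ (hmem i hi).1.1 (hlt i i' h hi') (hfin _ (hmem i' hi').2)
  · refine injOn_of_lt _ fun i i' h hi hi' => ?_
    simp only [hcount i hi, hcount i' hi']
    exact Nat.succ_lt_succ (Set.ncard_lt_ncard (beforeSet_ssubset (hmem i hi).1 h1
      (hmem i' hi').1.1 (hlt i i' h hi')) (hbfin _ (hmem i' hi').2))
  · intro i hi
    have hne : [] ≠ l i := fun h => (hmem i hi).2.2.1 0 (hs.1.trans h)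
    have := hrank [] (l i) h1.1 (isPrefix_lt ⟨_, rfl⟩ hne) (hfin _ (hmem i hi).2)
    exact (Nat.zero_le _).trans_lt this |>.ne'
  · refine Set.infinite_of_injective_forall_mem (f := fun k => {x ∈ t | x < η k}.ncard) ?_ ?_
    · exact (show StrictMono fun k => {x ∈ t | x < η k}.ncard from
        fun k k' h => hrank _ _ (hs.2.1 k) (hmono h) (hfinη k')).injective
    · rintro k ⟨i, hi, h⟩
      rcases lt_trichotomy (l i) (η k) with h' | h' | h'
      · exact (hrank _ _ (hmem i hi).1.1 h' (hfinη k)).ne h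
      · exact (hmem i hi).2.2.1 k h'.symm
      · exact (hrank _ _ (hs.2.1 k) h' (hfin _ (hmem i hi).2)).ne' h
  · refine (hinf.image (f := fun u => (beforeSet t u ∪ fringe t u).ncard) ?_).mono ?_
    · have hnp : ∀ u v, LeftOfSpine t η u → (∃ k c, v = η k ++ [c]) → u < v → ¬ u <+: v := by
        rintro u _ hu ⟨k, c, rfl⟩ h hp
        rw [List.prefix_concat_iff] at hp
        rcases hp with rfl | hp
        · exact lt_irrefl _ h
        · obtain ⟨i, hi⟩ := exists_spine_eq_of_isPrefix hs hp
          exact hu.2.1 i hi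
      refine (show StrictMonoOn (fun u => (beforeSet t u ∪ fringe t u).ncard) _ from ?_).injOn
      rintro u ⟨-, hu, -⟩ v ⟨hv', hv, -⟩ h
      exact Set.ncard_lt_ncard
        (beforeSet_union_fringe_ssubset hv.1 h (hnp u v hu hv' h)) (hufin v hv)
    · rintro _ ⟨u, ⟨-, hu, h2u⟩, rfl⟩ ⟨i, hi, h⟩
      rw [hcount i hi] at h
      exact ncard_beforeSet_ne h1 hu.1 (not_isLeaf_of_two_le_fringe h1 h2u) (hmem i hi).1
        (hufin u hu) (hbfin _ (hmem i hi).2) h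

end AvoidPaper
end

section
/- Let t ∈ 𝔗_∞ with infinite spine η_0, η_1, η_2, … and leaves l_1 < l_2 < ⋯ to the left of the spine in increasing lexicographic order; set s_i = #{v ∈ t : v < l_i} and p_i = |l_i|. Suppose s ∈ 𝔗_f is attached to t at a spine vertex η_k as a subtree lying strictly to the left of η_{k+1}, and let i* be the index such that l_{i*} is the right-most leaf of t in this copy of s. Then s_{i*+1} − p_{i*+1} + 1 ≥ s_{i*} − p_{i*} + 3. Consequently the set {i : s_{i+1} − p_{i+1} + 1 > s_i − p_i + 2} is infinite. -/
open Set Filter MeasureTheory Topology TopologicalSpace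
open scoped ENNReal

namespace AvoidPaper

/-! ## Lexicographic order and prefixes -/

theorem lt_append_of_ne_nil (a : Vertex) {z : Vertex} (hz : z ≠ []) : a < a ++ z := by
  induction a with
  | nil =>
    cases z with
    | nil => exact absurd rfl hz
    | cons b z => exact List.nil_lt_cons b z
  | cons b a ih => exact List.cons_lt_cons_iff.2 (Or.inr ⟨rfl, ih⟩)

theorem isPrefix_of_le_of_lt_append {a x z : Vertex} (hax : a ≤ x) (hxz : x < a ++ z) :
    a <+: x := by
  induction a generalizing x with
  | nil => exact ⟨x, rfl⟩
  | cons b a ih =>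
    cases x with
    | nil => exact absurd (List.nil_lt_cons b a) (not_lt.2 hax)
    | cons d x =>
      rw [List.cons_append, List.cons_lt_cons_iff] at hxz
      have hbd : ¬ (d < b ∨ d = b ∧ x < a) := fun h =>
        not_lt.2 hax (List.cons_lt_cons_iff.2 h)
      obtain h | ⟨rfl, h⟩ := hxz
      · exact absurd (Or.inl h) hbd
      · exact List.cons_prefix_cons.2
          ⟨rfl, ih (not_lt.1 fun h' => hbd (Or.inr ⟨rfl, h'⟩)) h⟩

theorem append_lt_of_lt_of_not_isPrefix {a b : Vertex} (z : Vertex) (hab : a < b)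
    (hpre : ¬ a <+: b) : a ++ z < b := by
  by_contra h
  rcases eq_or_lt_of_le (not_lt.1 h) with rfl | h
  · exact hpre (List.prefix_append _ _)
  · exact hpre (isPrefix_of_le_of_lt_append hab.le h)

/-! ## Fringe subtrees and leaves -/

theorem IsTree.mem_of_isPrefix {t : Set Vertex} (ht : IsTree t) {u v : Vertex} (huv : u <+: v)
    (hv : v ∈ t) : u ∈ t := by
  obtain ⟨w, rfl⟩ := huv
  exact ht.2.1 u w hv

theorem IsLeaf.eq_of_isPrefix {t : Set Vertex} (ht : IsTree t) {u v : Vertex} (hu : IsLeaf t u)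
    (huv : u <+: v) (hv : v ∈ t) : u = v := by
  obtain ⟨w, rfl⟩ := huv
  cases w with
  | nil => simp
  | cons a w =>
    refine absurd (ht.mem_of_isPrefix ⟨w, ?_⟩ hv) (hu.2 a)
    simp

theorem IsLeaf.length_lt_of_mem_fringe {t : Set Vertex} (ht : IsTree t) {u x : Vertex}
    (hfr : 2 ≤ (fringe t u).encard) (hx : IsLeaf t x) (hxu : x ∈ fringe t u) :
    u.length < x.length := by
  refine lt_of_le_of_ne hxu.2.length_le fun hlen => ?_
  obtain rfl : u = x := hxu.2.eq_of_length hlen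
  obtain ⟨y, hy, hne⟩ := (Set.one_lt_encard_iff_nontrivial.1
    (lt_of_lt_of_le (by norm_num) hfr)).exists_ne u
  exact hne (hx.eq_of_isPrefix ht hy.2 hy.1).symm

theorem exists_rightmost_leaf {t : Set Vertex} {u : Vertex} (hu : u ∈ t)
    (hfin : (fringe t u).Finite) :
    ∃ x, IsLeaf t x ∧ x ∈ fringe t u ∧ ∀ y ∈ fringe t u, y ≤ x := by
  obtain ⟨x, hx, hmax⟩ := Set.exists_max_image (fringe t u) id hfin ⟨u, hu, List.prefix_rfl⟩
  refine ⟨x, ⟨hx.1, fun i hi => ?_⟩, hx, hmax⟩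
  exact not_lt.2 (hmax (x ++ [i]) ⟨hi, hx.2.trans (List.prefix_append _ _)⟩)
    (lt_append_of_ne_nil x (List.cons_ne_nil i []))

theorem exists_child_infinite_fringe {t : Set Vertex} (ht : IsTree t) (hlf : LocFin t)
    {v : Vertex} (hv : (fringe t v).Infinite) : ∃ a : ℕ, (fringe t (v ++ [a])).Infinite := by
  by_contra! h
  refine hv (((Set.finite_singleton v).union
    ((hlf v).biUnion (t := fun a => fringe t (v ++ [a])) fun a _ => ?_)).subset ?_)
  · exact Set.not_infinite.1 (by simpa using h a)
  · rintro x ⟨hx, w, rfl⟩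
    cases w with
    | nil => exact Or.inl (by simp)
    | cons a w =>
      have hpre : v ++ [a] <+: v ++ a :: w := ⟨w, by simp⟩
      exact Or.inr (Set.mem_biUnion (ht.mem_of_isPrefix hpre hx) ⟨hx, hpre⟩)

theorem exists_spine_through {t : Set Vertex} (ht : IsTree t) (hlf : LocFin t) {v : Vertex}
    (hv : (fringe t v).Infinite) : ∃ η, IsSpine t η ∧ η v.length = v := by
  choose! f hf using fun (w : Vertex) (hw : (fringe t w).Infinite) =>
    exists_child_infinite_fringe ht hlf hw
  let g : ℕ → Vertex := fun n => Nat.rec v (fun _ w => w ++ [f w]) n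
  have hg_succ : ∀ n, g (n + 1) = g n ++ [f (g n)] := fun n => rfl
  have hg_inf : ∀ n, (fringe t (g n)).Infinite := by
    intro n
    induction n with
    | zero => exact hv
    | succ n ih => exact hf _ ih
  have hg_mem : ∀ n, g n ∈ t := fun n => by
    obtain ⟨x, hx⟩ := (hg_inf n).nonempty
    exact ht.mem_of_isPrefix hx.2 hx.1
  have hg_len : ∀ n, (g n).length = v.length + n := by
    intro n
    induction n with
    | zero => rfl
    | succ n ih => rw [hg_succ, List.length_append, ih, List.length_singleton]; omega
  have hg_pre : ∀ n, v <+: g n := by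
    intro n
    induction n with
    | zero => exact List.prefix_rfl
    | succ n ih => exact ih.trans (List.prefix_append _ _)
  refine ⟨fun n => (g n).take n, ⟨List.take_zero, fun n => ?_, fun n => ?_⟩, ?_⟩
  · exact ht.mem_of_isPrefix ⟨_, List.take_append_drop _ _⟩ (hg_mem n)
  · have hlt : n < (g (n + 1)).length :=
      lt_of_lt_of_eq (by omega) (hg_len (n + 1)).symm
    refine ⟨(g (n + 1))[n], ?_⟩
    have htake : (g (n + 1)).take n = (g n).take n := by
      rw [hg_succ, List.take_append_of_le_length (by rw [hg_len]; omega)]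
    change (g (n + 1)).take (n + 1) = (g n).take n ++ _
    rw [← htake, List.take_append_getElem]
  · exact (List.prefix_iff_eq_take.1 (hg_pre _)).symm

/-! ## The part of the tree to the left of the spine -/

theorem IsSpine.length_eq {t : Set Vertex} {η : ℕ → Vertex} (h : IsSpine t η) (n : ℕ) :
    (η n).length = n := by
  induction n with
  | zero => rw [h.1]; rfl
  | succ n ih =>
    obtain ⟨c, hc⟩ := h.2.2 n
    rw [hc, List.length_append, ih, List.length_singleton]

theorem IsSpine.eq_of_isPrefix {t : Set Vertex} {η : ℕ → Vertex} (h : IsSpine t η) {u : Vertex}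
    {n : ℕ} (hu : u <+: η n) : ∃ j, η j = u := by
  induction n with
  | zero =>
    rw [h.1, List.prefix_nil] at hu
    exact ⟨0, h.1.trans hu.symm⟩
  | succ n ih =>
    obtain ⟨c, hc⟩ := h.2.2 n
    rw [hc, List.prefix_concat_iff] at hu
    rcases hu with hu | hu
    · exact ⟨n + 1, hc.trans hu.symm⟩
    · exact ih hu

theorem SpineSpec.finite_fringe {t : Set Vertex} {η : ℕ → Vertex} (ht : IsTree t)
    (hlf : LocFin t) (h : SpineSpec t η) {v : Vertex} (hv : ∀ i, η i ≠ v) :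
    (fringe t v).Finite := by
  by_contra hinf
  obtain ⟨η', hη', hpass⟩ := exists_spine_through ht hlf hinf
  rw [h.2.1 η' hη'] at hpass
  exact hv _ hpass

theorem SpineSpec.finite_lt_spine {t : Set Vertex} {η : ℕ → Vertex} (ht : IsTree t)
    (hlf : LocFin t) (h : SpineSpec t η) (n : ℕ) : {x ∈ t | x < η n}.Finite := by
  induction n with
  | zero =>
    refine Set.finite_empty.subset fun x hx => ?_
    have := hx.2
    rw [h.1.1] at this
    exact List.not_lt_nil x this
  | succ n ih =>
    obtain ⟨c, hc⟩ := h.1.2.2 n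
    refine ((ih.union (Set.finite_singleton (η n))).union
      ((Set.finite_Iio c).biUnion (t := fun a => fringe t (η n ++ [a]))
        fun a ha => ?_)).subset ?_
    · refine h.finite_fringe ht hlf fun j hj => ?_
      have hlen := congrArg List.length hj
      rw [List.length_append, h.1.length_eq, h.1.length_eq, List.length_singleton] at hlen
      subst hlen
      rw [hc] at hj
      have hca : c = a := by simpa using hj
      exact (Set.mem_Iio.1 ha).ne hca.symm
    · rintro x ⟨hx, hlt⟩
      rcases lt_or_ge x (η n) with hxn | hxn
      · exact Or.inl (Or.inl ⟨hx, hxn⟩)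
      rw [hc] at hlt
      obtain ⟨w, rfl⟩ := isPrefix_of_le_of_lt_append hxn hlt
      cases w with
      | nil => exact Or.inl (Or.inr (by simp))
      | cons a w =>
        refine Or.inr (Set.mem_biUnion (x := a) ?_ ⟨hx, w, by simp⟩)
        by_contra hac
        rcases eq_or_lt_of_le (not_lt.1 (mt Set.mem_Iio.2 hac)) with rfl | hca
        · refine not_lt.2 ?_ hlt
          rcases eq_or_ne w [] with rfl | hw
          · exact le_rfl
          · have := lt_append_of_ne_nil (η n ++ [c]) hw
            simpa using this.le
        · refine lt_asymm hlt ?_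
          exact List.append_left_lt (List.cons_lt_cons_iff.2 (Or.inl hca))

theorem LeftOfSpine.of_mem_fringe {t : Set Vertex} {η : ℕ → Vertex} (hη : IsSpine t η)
    {u x : Vertex} (hu : LeftOfSpine t η u) (hx : x ∈ fringe t u) : LeftOfSpine t η x := by
  have hpre : ∀ n, ¬ u <+: η n := fun n hn => by
    obtain ⟨j, hj⟩ := hη.eq_of_isPrefix hn
    exact hu.2.1 j hj
  obtain ⟨j, hj⟩ := hu.2.2
  refine ⟨hx.1, fun n hn => hpre n (hn ▸ hx.2), j, ?_⟩
  obtain ⟨w, rfl⟩ := hx.2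
  exact append_lt_of_lt_of_not_isPrefix w hj (hpre j)

/-- Distinct subtrees attached to the left of the spine are disjoint. -/
theorem IsSpine.eq_of_mem_fringe {t : Set Vertex} {η : ℕ → Vertex} (hη : IsSpine t η)
    {u v x : Vertex} (hu : ∃ k c, u = η k ++ [c]) (hv : ∃ k c, v = η k ++ [c])
    (hul : LeftOfSpine t η u) (hvl : LeftOfSpine t η v) (hxu : x ∈ fringe t u)
    (hxv : x ∈ fringe t v) : u = v := by
  have key : ∀ {a b : Vertex}, (∃ k c, b = η k ++ [c]) → LeftOfSpine t η a → a <+: b →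
      a = b := by
    rintro a b ⟨k, c, rfl⟩ ha hab
    rcases List.prefix_concat_iff.1 hab with h | h
    · exact h
    · obtain ⟨j, hj⟩ := hη.eq_of_isPrefix h
      exact absurd hj (ha.2.1 j)
  rcases le_total u.length v.length with h | h
  · exact key hv hul (List.prefix_of_prefix_length_le hxu.2 hxv.2 h)
  · exact (key hu hvl (List.prefix_of_prefix_length_le hxv.2 hxu.2 h)).symm

/-- If `x < y` are leaves with `x`, but not `y`, in the fringe subtree at `u`, then `x` and the
strict ancestors of `y` of height at least `|u|` all lie in `[x, y)`. -/
theorem ncard_lt_add_length_le {t : Set Vertex} (ht : IsTree t) {u x y : Vertex}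
    (hx : IsLeaf t x) (hxu : x ∈ fringe t u) (hy : y ∈ t) (hyu : y ∉ fringe t u)
    (hxy : x < y) (hfin : {z ∈ t | z < y}.Finite) :
    {z ∈ t | z < x}.ncard + 1 + y.length ≤ {z ∈ t | z < y}.ncard + u.length := by
  let P : Set Vertex := (fun n => y.take n) '' Set.Ico u.length y.length
  have hP : ∀ z ∈ P, z <+: y ∧ x < z ∧ z < y := by
    rintro z ⟨n, ⟨hn, hny⟩, rfl⟩
    have hpre : y.take n <+: y := ⟨_, List.take_append_drop n y⟩
    have hlen : (y.take n).length = n := by rw [List.length_take]; omega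
    refine ⟨hpre, lt_of_not_ge fun hle => ?_, ?_⟩
    · have hzx : y.take n <+: x := by
        rw [← List.take_append_drop n y] at hxy
        exact isPrefix_of_le_of_lt_append hle hxy
      exact hyu ⟨hy, (List.prefix_of_prefix_length_le hxu.2 hzx (by omega)).trans hpre⟩
    · have := lt_append_of_ne_nil (y.take n) (z := y.drop n)
        (List.ne_nil_of_length_pos (by rw [List.length_drop]; omega))
      rwa [List.take_append_drop] at this
  have hPcard : P.ncard = y.length - u.length := by
    rw [Set.InjOn.ncard_image, Set.ncard_eq_toFinset_card', Set.toFinset_Ico, Nat.card_Ico]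
    intro m hm n hn hmn
    have := congrArg List.length hmn
    simp only [List.length_take] at this
    have := hm.2
    have := hn.2
    omega
  have hPfin : P.Finite := (Set.finite_Ico _ _).image _
  have hAfin : {z ∈ t | z < x}.Finite := hfin.subset fun z hz => ⟨hz.1, hz.2.trans hxy⟩
  have hsub : insert x ({z ∈ t | z < x} ∪ P) ⊆ {z ∈ t | z < y} := by
    rintro z (rfl | hz | hz)
    · exact ⟨hx.1, hxy⟩
    · exact ⟨hz.1, hz.2.trans hxy⟩
    · exact ⟨ht.mem_of_isPrefix (hP z hz).1 hy, (hP z hz).2.2⟩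
  have hcard := Set.ncard_le_ncard hsub hfin
  rw [Set.ncard_insert_of_notMem _ (hAfin.union hPfin), Set.ncard_union_eq _ hAfin hPfin,
    hPcard] at hcard
  · omega
  · exact Set.disjoint_left.2 fun z hz hzP => lt_asymm hz.2 (hP z hzP).2.1
  · rintro (h | h)
    · exact lt_irrefl x h.2
    · exact lt_irrefl x (hP x h).2.1

/-! ## Enumerations of infinite sets -/

theorem IsEnumOf.mem {A : Set Vertex} {l : ℕ → Vertex} (hl : IsEnumOf A l) (hA : A.Infinite)
    (n : ℕ) : l n ∈ A :=
  (hl n (by rw [hA.encard_eq]; exact ENat.natCast_lt_top n)).1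

theorem IsEnumOf.setOf_lt {A : Set Vertex} {l : ℕ → Vertex} (hl : IsEnumOf A l)
    (hA : A.Infinite) (n : ℕ) : {x ∈ A | x < l n} = l '' {j | j < n} :=
  (hl n (by rw [hA.encard_eq]; exact ENat.natCast_lt_top n)).2

theorem IsEnumOf.strictMono {A : Set Vertex} {l : ℕ → Vertex} (hl : IsEnumOf A l)
    (hA : A.Infinite) : StrictMono l := by
  intro m n hmn
  have h : l m ∈ l '' {j | j < n} := ⟨m, hmn, rfl⟩
  rw [← hl.setOf_lt hA] at h
  exact h.2

theorem IsEnumOf.exists_eq {A : Set Vertex} {l : ℕ → Vertex} (hl : IsEnumOf A l)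
    (hA : A.Infinite) {x : Vertex} (hx : x ∈ A) (hfin : {y ∈ A | y < x}.Finite) :
    ∃ n, l n = x := by
  obtain ⟨n, hn⟩ : ∃ n, x ≤ l n := by
    by_contra! h
    exact Set.infinite_of_injective_forall_mem (hl.strictMono hA).injective
      (fun n => (⟨hl.mem hA n, h n⟩ : l n ∈ {y ∈ A | y < x})) hfin
  rcases eq_or_lt_of_le hn with h | h
  · exact ⟨n, h.symm⟩
  · have hmem : x ∈ {y ∈ A | y < l n} := ⟨hx, h⟩
    rw [hl.setOf_lt hA] at hmem
    obtain ⟨m, -, hm⟩ := hmem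
    exact ⟨m, hm⟩

/-- Let `t ∈ 𝔗_∞` with spine `η` and left-of-spine leaves `l`.  If a
tree `s ∈ 𝔗_f` is attached to `t` at the spine vertex `η k` strictly to the left of
`η (k+1)`, and `l i*` is the right-most leaf of `t` inside this copy of `s`, then
`s_{i*+1} - p_{i*+1} + 1 ≥ s_{i*} - p_{i*} + 3` (written additively).  Consequently the
set `{i : s_{i+1} - p_{i+1} + 1 > s_i - p_i + 2}` is infinite. -/
theorem left_subtree_gap (t : Set Vertex) (η : ℕ → Vertex)
    (h1 : IsTree t) (h2 : LocFin t) (h3 : t.Infinite) (h4 : SpineSpec t η)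
    (l : ℕ → Vertex) (hl : IsEnumOf (leftLeaves t η) l)
    (s : Set Vertex) (hs : MemTf s)
    (k c i : ℕ) (hc : η (k + 1) = η k ++ [c]) (hleft : i < c)
    (hattach : fringe t (η k ++ [i]) = (fun u : Vertex => (η k ++ [i]) ++ u) '' s)
    (iStar : ℕ)
    (hstar1 : IsLeaf t (l iStar)) (hstar2 : l iStar ∈ fringe t (η k ++ [i]))
    (hstar3 : ∀ x : Vertex, IsLeaf t x → x ∈ fringe t (η k ++ [i]) → x ≤ l iStar) :
    sVal t l iStar + pVal l (iStar + 1) + 2 ≤ sVal t l (iStar + 1) + pVal l iStar ∧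
    {m : ℕ | sVal t l m + pVal l (m + 1) + 1 < sVal t l (m + 1) + pVal l m}.Infinite := by
  let U : Set Vertex := {u | (∃ k c, u = η k ++ [c]) ∧ LeftOfSpine t η u ∧
    2 ≤ (fringe t u).encard}
  have hU : U.Infinite := h4.2.2.2.2
  choose! r hr_leaf hr_mem hr_max using fun (u : Vertex) (hu : u ∈ U) =>
    exists_rightmost_leaf hu.2.1.1 (h4.finite_fringe h1 h2 hu.2.1.2.1)
  have hr_left : ∀ u ∈ U, r u ∈ leftLeaves t η := fun u hu =>
    ⟨hr_leaf u hu, hu.2.1.of_mem_fringe h4.1 (hr_mem u hu)⟩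
  have hr_inj : Set.InjOn r U := fun u hu v hv huv =>
    h4.1.eq_of_mem_fringe hu.1 hv.1 hu.2.1 hv.2.1 (hr_mem u hu) (huv ▸ hr_mem v hv)
  have hA : (leftLeaves t η).Infinite := Set.infinite_of_injOn_mapsTo hr_inj hr_left hU
  have hfin : ∀ x, LeftOfSpine t η x → {z ∈ t | z < x}.Finite := fun x hx => by
    obtain ⟨j, hj⟩ := hx.2.2
    exact (h4.finite_lt_spine h1 h2 j).subset fun z hz => ⟨hz.1, hz.2.trans hj⟩
  have gap : ∀ (u : Vertex) (m : ℕ), 2 ≤ (fringe t u).encard → IsLeaf t (l m) →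
      l m ∈ fringe t u → (∀ x, IsLeaf t x → x ∈ fringe t u → x ≤ l m) →
      sVal t l m + pVal l (m + 1) + 2 ≤ sVal t l (m + 1) + pVal l m := by
    intro u m hu hleaf hmem hmax
    have hlt : l m < l (m + 1) := hl.strictMono hA m.lt_succ_self
    have hnext := hl.mem hA (m + 1)
    have hlen := hleaf.length_lt_of_mem_fringe h1 hu hmem
    have hcard := ncard_lt_add_length_le h1 hleaf hmem hnext.1.1
      (fun h => not_lt.2 (hmax _ hnext.1 h) hlt) hlt (hfin _ hnext.2)
    unfold sVal pVal
    omega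
  refine ⟨gap (η k ++ [i]) iStar ?_ hstar1 hstar2 hstar3, ?_⟩
  · rw [hattach, (List.append_right_injective (η k ++ [i])).encard_image]
    exact hs.2.2
  · choose! m hm using fun (u : Vertex) (hu : u ∈ U) =>
      hl.exists_eq hA (hr_left u hu)
        ((hfin _ (hr_left u hu).2).subset fun z hz => ⟨hz.1.1.1, hz.2⟩)
    refine Set.infinite_of_injOn_mapsTo (f := m) (s := U) ?_ ?_ hU
    · intro u hu v hv huv
      exact hr_inj hu hv (by rw [← hm u hu, ← hm v hv, huv])
    · intro u hu
      have hgap := gap u (m u) hu.2.2 (by rw [hm u hu]; exact hr_leaf u hu)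
        (by rw [hm u hu]; exact hr_mem u hu)
        (fun x _ hx => by rw [hm u hu]; exact hr_max u hu x hx)
      exact hgap

end AvoidPaper
end
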